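/- arXiv:2502.07151 — 6 statements merged into one kernel-verified Lean document; each statement's English description precedes it below -/
import Mathlib

section
/- Let Y be a random vector in ℝ^d with E[|Y|²] < ∞ and let n ≥ 1. Then there exists at least one optimal quantizer, i.e. some α* ∈ (ℝ^d)ⁿ such that D_n(α*) = inf over α ∈ (ℝ^d)ⁿ of D_n(α). -/
open MeasureTheory ProbabilityTheory ENNReal

open Filter Topology in
/-- Finitely many sequences in a proper space have a common subsequence along which each of them
converges or escapes to infinity. -/
theorem exists_subseq_tendsto_nhds_or_cobounded {ι E : Type*} [PseudoMetricSpace E] [ProperSpace E]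
    (s : Finset ι) (u : ℕ → ι → E) :
    ∃ φ : ℕ → ℕ, StrictMono φ ∧ ∀ i ∈ s,
      (∃ a, Tendsto (fun k => u (φ k) i) atTop (𝓝 a)) ∨
        Tendsto (fun k => u (φ k) i) atTop (Bornology.cobounded E) := by
  classical
  induction s using Finset.induction_on with
  | empty => exact ⟨id, strictMono_id, by simp⟩
  | insert j s _ ih =>
    obtain ⟨φ, hφ, h⟩ := ih
    by_cases hj : Tendsto (fun k => u (φ k) j) atTop (Bornology.cobounded E)
    · refine ⟨φ, hφ, fun i hi => ?_⟩
      rcases Finset.mem_insert.1 hi with rfl | hi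
      exacts [Or.inr hj, h i hi]
    · obtain ⟨t, ht, hfreq⟩ : ∃ t : Set E, Bornology.IsBounded t ∧
          ∃ᶠ k in atTop, u (φ k) j ∈ t := by
        rw [tendsto_def] at hj
        push Not at hj
        obtain ⟨t, ht, hn⟩ := hj
        exact ⟨tᶜ, Bornology.isBounded_def.2 (by simpa using ht),
          fun h => hn (h.mono fun k hk => not_not.1 hk)⟩
      obtain ⟨a, -, ψ, hψ, ha⟩ := tendsto_subseq_of_frequently_bounded ht hfreq
      refine ⟨φ ∘ ψ, hφ.comp hψ, fun i hi => ?_⟩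
      rcases Finset.mem_insert.1 hi with rfl | hi
      · exact Or.inl ⟨a, ha⟩
      · exact (h i hi).imp (fun ⟨b, hb⟩ => ⟨b, hb.comp hψ.tendsto_atTop⟩)
          fun hb => hb.comp hψ.tendsto_atTop

/-- The squared distance to a finite family of points is integrable. -/
theorem integrable_iInf_norm_sub_sq {Ω ι E : Type*} [MeasurableSpace Ω] {P : Measure Ω}
    [IsFiniteMeasure P] [Finite ι] [Nonempty ι] [NormedAddCommGroup E] [MeasurableSpace E]
    [BorelSpace E] [SecondCountableTopology E] {Y : Ω → E} (hY : Measurable Y)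
    (hY2 : Integrable (fun ω => ‖Y ω‖ ^ 2) P) (α : ι → E) :
    Integrable (fun ω => ⨅ i, ‖Y ω - α i‖ ^ 2) P := by
  have i₀ : ι := Classical.arbitrary ι
  have hm : MemLp (fun ω => Y ω - α i₀) 2 P :=
    ((memLp_two_iff_integrable_sq_norm hY.aestronglyMeasurable).2 hY2).sub (memLp_const _)
  refine Integrable.mono' hm.integrable_norm_pow' ?_ (ae_of_all _ fun ω => ?_)
  · exact (Measurable.iInf fun i => (hY.sub_const _).norm.pow_const 2).aestronglyMeasurable
  · rw [Real.norm_of_nonneg (Real.iInf_nonneg fun i => by positivity)]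
    exact ciInf_le (Set.finite_range _).bddBelow i₀

open Filter Topology in
/-- A bound valid at the limits of the convergent components of a sequence of quantizers, the other
components escaping to infinity, holds eventually. -/
theorem eventually_le_iInf_norm_sub_sq {ι E : Type*} [Finite ι] [Nonempty ι]
    [NormedAddCommGroup E] {u : ℕ → ι → E} (y : E) {c : ℝ}
    (h : ∀ i, (∃ a, Tendsto (fun k => u k i) atTop (𝓝 a) ∧ c < ‖y - a‖ ^ 2) ∨
      Tendsto (fun k => u k i) atTop (Bornology.cobounded E)) :
    ∀ᶠ k in atTop, c ≤ ⨅ i, ‖y - u k i‖ ^ 2 := by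
  have key : ∀ i, ∀ᶠ k in atTop, c ≤ ‖y - u k i‖ ^ 2 := by
    intro i
    rcases h i with ⟨a, ha, hc⟩ | hi
    · exact (((tendsto_const_nhds.sub ha).norm.pow 2).eventually (lt_mem_nhds hc)).mono
        fun _ => le_of_lt
    · have h1 : Tendsto (fun k => ‖y - u k i‖) atTop atTop := by
        refine tendsto_atTop_mono (f := fun k => ‖u k i‖ - ‖y‖) (fun k => ?_)
          (tendsto_atTop_add_const_right _ _ (tendsto_norm_cobounded_atTop.comp hi))
        rw [norm_sub_rev]
        exact norm_sub_norm_le _ _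
      exact ((tendsto_pow_atTop two_ne_zero).comp h1).eventually_ge_atTop c
  filter_upwards [eventually_all.2 key] with k hk using le_ciInf hk

open Filter Topology in
/-- The quadratic distortion of a square-integrable random vector attains its minimum over
families of points indexed by a finite nonempty type. -/
theorem exists_forall_integral_iInf_norm_sub_sq_le {Ω ι E : Type*} [MeasurableSpace Ω]
    {P : Measure Ω} [IsFiniteMeasure P] [Finite ι] [Nonempty ι] [NormedAddCommGroup E]
    [ProperSpace E] [MeasurableSpace E] [BorelSpace E] {Y : Ω → E} (hY : Measurable Y)
    (hY2 : Integrable (fun ω => ‖Y ω‖ ^ 2) P) :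
    ∃ β : ι → E, ∀ α : ι → E,
      ∫ ω, ⨅ i, ‖Y ω - β i‖ ^ 2 ∂P ≤ ∫ ω, ⨅ i, ‖Y ω - α i‖ ^ 2 ∂P := by
  have := Fintype.ofFinite ι
  set f : (ι → E) → Ω → ℝ := fun α ω => ⨅ i, ‖Y ω - α i‖ ^ 2
  have hf0 : ∀ α ω, 0 ≤ f α ω := fun α ω => Real.iInf_nonneg fun i => by positivity
  have hfi : ∀ α, Integrable (f α) P := integrable_iInf_norm_sub_sq hY hY2
  have hfm : ∀ α, Measurable (f α) := fun α =>
    Measurable.iInf fun i => (hY.sub_const _).norm.pow_const 2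
  set D : (ι → E) → ℝ := fun α => ∫ ω, f α ω ∂P
  have hlint : ∀ α, ∫⁻ ω, ENNReal.ofReal (f α ω) ∂P = ENNReal.ofReal (D α) := fun α =>
    (ofReal_integral_eq_lintegral_ofReal (hfi α) (ae_of_all _ (hf0 α))).symm
  have hD0 : ∀ α, 0 ≤ D α := fun α => integral_nonneg (hf0 α)
  have hbdd : BddBelow (Set.range D) := ⟨0, Set.forall_mem_range.2 hD0⟩
  obtain ⟨v, -, hv, hmem⟩ := exists_seq_tendsto_sInf (Set.range_nonempty D) hbdd
  choose w hw using hmem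
  obtain ⟨φ, hφ, hsub⟩ := exists_subseq_tendsto_nhds_or_cobounded Finset.univ w
  set u : ℕ → ι → E := fun k => w (φ k) with hu
  have hDu : Tendsto (fun k => D (u k)) atTop (𝓝 (sInf (Set.range D))) := by
    simpa only [hu, hw, Function.comp_def] using hv.comp hφ.tendsto_atTop
  have fatou : ∫⁻ ω, liminf (fun k => ENNReal.ofReal (f (u k) ω)) atTop ∂P
      ≤ ENNReal.ofReal (sInf (Set.range D)) := by
    refine (lintegral_liminf_le fun k => (hfm (u k)).ennreal_ofReal).trans_eq ?_
    simp_rw [hlint]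
    exact (ENNReal.tendsto_ofReal hDu).liminf_eq
  have hβ : ∀ i, ∃ a, Tendsto (fun k => u k i) atTop (𝓝 a) ∨
      Tendsto (fun k => u k i) atTop (Bornology.cobounded E) := fun i =>
    (hsub i (Finset.mem_univ i)).elim (fun ⟨a, ha⟩ => ⟨a, Or.inl ha⟩) fun h => ⟨0, Or.inr h⟩
  choose β hβ using hβ
  refine ⟨β, fun α => le_trans ?_ (csInf_le hbdd ⟨α, rfl⟩)⟩
  rw [← ENNReal.ofReal_le_ofReal_iff (Real.sInf_nonneg (Set.forall_mem_range.2 hD0))]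
  refine (hlint β).symm.trans_le ((lintegral_mono fun ω => ?_).trans fatou)
  refine le_of_forall_lt fun c hc => ?_
  obtain ⟨r, hcr, hr⟩ := ENNReal.lt_iff_exists_real_btwn.1 hc |>.imp fun _ h => h.2
  refine hcr.trans_le (le_liminf_of_le (by isBoundedDefault) ?_)
  have hrf : r < f β ω := (ENNReal.ofReal_lt_ofReal_iff'.1 hr).1
  refine (eventually_le_iInf_norm_sub_sq (Y ω) fun i =>
    (hβ i).imp (fun h => ⟨β i, h, ?_⟩) id).mono fun k hk => ENNReal.ofReal_le_ofReal hk
  exact hrf.trans_le (ciInf_le (Set.finite_range _).bddBelow i)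

/-- For a square-integrable random vector `Y` in `ℝ^d` and `n ≥ 1`, there exists
an optimal quantizer `α* ∈ (ℝ^d)ⁿ`, i.e. `D_n(α*) = inf_{α ∈ (ℝ^d)ⁿ} D_n(α)` where
`D_n(α) = E[min_{1≤i≤n} |Y − α_i|²]`. -/
theorem exists_optimal_quantizer
    {Ω : Type*} [MeasurableSpace Ω] (P : Measure Ω) [IsProbabilityMeasure P]
    {d n : ℕ} (hn : 1 ≤ n)
    (Y : Ω → EuclideanSpace ℝ (Fin d)) (hY : Measurable Y)
    (hY2 : Integrable (fun ω => ‖Y ω‖ ^ 2) P) :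
    ∃ αstar : Fin n → EuclideanSpace ℝ (Fin d),
      ∫ ω, ⨅ i, ‖Y ω - αstar i‖ ^ 2 ∂P
        = ⨅ α : Fin n → EuclideanSpace ℝ (Fin d), ∫ ω, ⨅ i, ‖Y ω - α i‖ ^ 2 ∂P := by
  have : NeZero n := ⟨by omega⟩
  obtain ⟨β, hβ⟩ := exists_forall_integral_iInf_norm_sub_sq_le (ι := Fin n) hY hY2
  exact ⟨β, le_antisymm (le_ciInf hβ) (ciInf_le ⟨_, Set.forall_mem_range.2 hβ⟩ β)⟩
end

section
/- (Theorem 1, part 1, first identity) Let X be a random element of a measurable space E and Y a random vector in ℝ^d on the same probability space, with regular conditional distribution Q(x, dy) of Y given X, and let f = (f₁,…,fₙ) : E → (ℝ^d)ⁿ be measurable with Δ_n(f) < ∞. Then, with probability 1, E[min_{1≤i≤n} |Y − f_i(X)|² | X] = ∫_{ℝ^d} min_{1≤i≤n} |y − f_i(X)|² Q(X, dy) = W₂(Q(X,·), Q̂_f(X,·))², where Q̂_f(x,·) = Σ_{i=1}^n Q(x, {y : π_{f(x)}(y) = f_i(x)}) δ_{f_i(x)} is the conditional law of π_{f(X)}(Y)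 given X. -/
open MeasureTheory ProbabilityTheory ENNReal

/-- A coupling of `μ` and `ν`: a measure on the product space with the prescribed marginals. -/
def IsCoupling {d : ℕ}
    (π : Measure (EuclideanSpace ℝ (Fin d) × EuclideanSpace ℝ (Fin d)))
    (μ ν : Measure (EuclideanSpace ℝ (Fin d))) : Prop :=
  π.map Prod.fst = μ ∧ π.map Prod.snd = ν

/-- The order-2 Wasserstein distance `W₂(μ,ν) = inf over couplings of (E[|Y₁ − Y₂|²])^{1/2}`. -/
noncomputable def W2 {d : ℕ} (μ ν : Measure (EuclideanSpace ℝ (Fin d))) : ℝ≥0∞ :=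
  ⨅ (π : Measure (EuclideanSpace ℝ (Fin d) × EuclideanSpace ℝ (Fin d)))
    (_ : IsCoupling π μ ν),
      (∫⁻ q, ((‖q.1 - q.2‖₊ : ℝ≥0∞) ^ 2) ∂π) ^ ((1 : ℝ) / 2)

lemma iInf_sq_eq_sq_iInf {n : ℕ} (hn : 1 ≤ n) (a : Fin n → ℝ) (ha : ∀ i, 0 ≤ a i) :
    ⨅ i, a i ^ 2 = (⨅ i, a i) ^ 2 := by
  have : Nonempty (Fin n) := ⟨⟨0, hn⟩⟩
  obtain ⟨j, hj⟩ := exists_eq_ciInf_of_finite (f := a)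
  have hle (i : Fin n) : a j ≤ a i := hj ▸ ciInf_le (Finite.bddBelow_range a) i
  rw [← hj]
  refine le_antisymm (ciInf_le (Finite.bddBelow_range fun i => a i ^ 2) j) (le_ciInf fun i => ?_)
  exact pow_le_pow_left₀ (ha j) (hle i) 2

/-- Pushing `μ` forward along a nearest-point projection onto a measurable set `s` is optimal among
all couplings of `μ` with its image. -/
lemma W2_map_nearest_sq {d : ℕ} (μ : Measure (EuclideanSpace ℝ (Fin d)))
    {s : Set (EuclideanSpace ℝ (Fin d))} (hs : MeasurableSet s)
    {q : EuclideanSpace ℝ (Fin d) → EuclideanSpace ℝ (Fin d)} (hq : Measurable q)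
    (hmem : ∀ y, q y ∈ s) (hnear : ∀ y, ∀ z ∈ s, ‖y - q y‖ ≤ ‖y - z‖) :
    W2 μ (μ.map q) ^ 2 = ∫⁻ y, (‖y - q y‖₊ : ℝ≥0∞) ^ 2 ∂μ := by
  have hrpow (c : ℝ≥0∞) : (c ^ ((1 : ℝ) / 2)) ^ 2 = c := by
    rw [← ENNReal.rpow_natCast, ← ENNReal.rpow_mul]
    norm_num
  have hgraph : Measurable fun y => (y, q y) := measurable_id.prodMk hq
  suffices W2 μ (μ.map q) = (∫⁻ y, (‖y - q y‖₊ : ℝ≥0∞) ^ 2 ∂μ) ^ ((1 : ℝ) / 2) by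
    rw [this, hrpow]
  refine le_antisymm ?_ (le_iInf₂ fun π hπ => ?_)
  · refine (iInf₂_le (μ.map fun y => (y, q y)) ⟨?fst, ?snd⟩).trans_eq ?_
    case fst =>
      rw [Measure.map_map measurable_fst hgraph]
      exact Measure.map_id
    case snd =>
      rw [Measure.map_map measurable_snd hgraph]
      rfl
    rw [lintegral_map (by fun_prop) hgraph]
  · refine ENNReal.rpow_le_rpow ?_ (by norm_num)
    have hsupp : ∀ᵐ z ∂π, z.2 ∈ s := by
      have h : ∀ᵐ y ∂(π.map Prod.snd), y ∈ s := by
        rw [hπ.2]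
        exact (ae_map_iff hq.aemeasurable hs).2 (.of_forall hmem)
      exact ae_of_ae_map measurable_snd.aemeasurable h
    nth_rw 1 [← hπ.1]
    rw [lintegral_map (by fun_prop) measurable_fst]
    refine lintegral_mono_ae ?_
    filter_upwards [hsupp] with z hz
    gcongr
    exact hnear z.1 z.2 hz

/-- Theorem 1, part 1, first identity: with `Q` a regular conditional
distribution of `Y` given `X`, `f : E → (ℝ^d)ⁿ` measurable with `Δ_n(f) < ∞`, and
`p x = π_{f(x)}` a jointly measurable nearest-neighbor projection, one has, with
probability `1`:
`E[min_{1≤i≤n} |Y − f_i(X)|² | X] = ∫ min_{1≤i≤n} |y − f_i(X)|² Q(X, dy)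
  = W₂(Q(X,·), Q̂_f(X,·))²`,
where `Q̂_f(x,·) = (Q x).map (p x)` is the conditional law of `π_{f(X)}(Y)` given `X = x`. -/
theorem conditional_distortion_eq_wasserstein_sq
    {Ω : Type*} [MeasurableSpace Ω] (P : Measure Ω) [IsProbabilityMeasure P]
    {E : Type*} [mE : MeasurableSpace E]
    {d n : ℕ} (hn : 1 ≤ n)
    (X : Ω → E) (hX : Measurable X)
    (Y : Ω → EuclideanSpace ℝ (Fin d)) (hY : Measurable Y)
    (Q : Kernel E (EuclideanSpace ℝ (Fin d))) [IsMarkovKernel Q]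
    (hQ : P.map (fun ω => (X ω, Y ω)) = (P.map X).compProd Q)
    (f : E → Fin n → EuclideanSpace ℝ (Fin d)) (hf : Measurable f)
    (hΔ : ∫⁻ ω, ⨅ i, ((‖Y ω - f (X ω) i‖₊ : ℝ≥0∞) ^ 2) ∂P < ⊤)
    (p : E → EuclideanSpace ℝ (Fin d) → EuclideanSpace ℝ (Fin d))
    (hp_meas : Measurable (fun q : E × EuclideanSpace ℝ (Fin d) => p q.1 q.2))
    (hp_mem : ∀ x y, ∃ i, p x y = f x i)
    (hp_near : ∀ x y, ‖y - p x y‖ = ⨅ i, ‖y - f x i‖) :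
    (P[(fun ω => ⨅ i, ‖Y ω - f (X ω) i‖ ^ 2) | MeasurableSpace.comap X mE]
        =ᵐ[P] fun ω => ∫ y, ⨅ i, ‖y - f (X ω) i‖ ^ 2 ∂(Q (X ω))) ∧
    (∀ᵐ ω ∂P,
      ENNReal.ofReal (∫ y, ⨅ i, ‖y - f (X ω) i‖ ^ 2 ∂(Q (X ω)))
        = W2 (Q (X ω)) ((Q (X ω)).map (p (X ω))) ^ 2) := by
  have hmin (x : E) (y : EuclideanSpace ℝ (Fin d)) :
      ⨅ i, ‖y - f x i‖ ^ 2 = ‖y - p x y‖ ^ 2 := by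
    rw [iInf_sq_eq_sq_iInf hn _ fun i => norm_nonneg _, hp_near]
  have hle (x : E) (y : EuclideanSpace ℝ (Fin d)) (i : Fin n) : ‖y - p x y‖ ≤ ‖y - f x i‖ :=
    hp_near x y ▸ ciInf_le (Finite.bddBelow_range fun i => ‖y - f x i‖) i
  have hXY : Measurable fun ω => (X ω, Y ω) := hX.prodMk hY
  have hfin : ∫⁻ z, (‖z.2 - p z.1 z.2‖₊ : ℝ≥0∞) ^ 2 ∂((P.map X).compProd Q) < ⊤ := by
    rw [← hQ, lintegral_map (by fun_prop) hXY]
    refine (lintegral_mono fun ω => le_iInf fun i => ?_).trans_lt hΔ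
    gcongr
    exact hle (X ω) (Y ω) i
  have hint : Integrable (fun z : E × EuclideanSpace ℝ (Fin d) => ‖z.2 - p z.1 z.2‖ ^ 2)
      (P.map fun ω => (X ω, Y ω)) := by
    refine ⟨by fun_prop, ?_⟩
    rw [hQ, HasFiniteIntegral]
    simpa [enorm_pow, enorm_eq_nnnorm] using hfin
  simp only [hmin]
  constructor
  · have hcond : condDistrib Y X P =ᵐ[P.map X] Q :=
      condDistrib_ae_eq_of_measure_eq_compProd X hY.aemeasurable hQ
    refine (condExp_prod_ae_eq_integral_condDistrib' hX hY.aemeasurable hint).trans ?_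
    filter_upwards [ae_of_ae_map hX.aemeasurable hcond] with ω hω
    rw [hω]
  · rw [hQ] at hint
    filter_upwards [ae_of_ae_map hX.aemeasurable
        ((Measure.integrable_compProd_iff hint.1).1 hint).1] with ω hω
    rw [W2_map_nearest_sq (Q (X ω)) (Set.finite_range (f (X ω))).measurableSet
        (q := p (X ω)) (hp_meas.comp measurable_prodMk_left)
        (fun y => (hp_mem (X ω) y).imp fun _ h => h.symm)
        (fun y z ⟨i, hi⟩ => hi ▸ hle (X ω) y i),
      ofReal_integral_eq_lintegral_ofReal hω (.of_forall fun y => by positivity)]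
    refine lintegral_congr fun y => ?_
    rw [ENNReal.ofReal_pow (norm_nonneg _), ofReal_norm, enorm_eq_nnnorm]
end

section
/- (Theorem 1, part 2) Let X be a random element of a measurable space E and Y a random vector in ℝ^d on the same probability space, with regular conditional distribution Q(x, dy) of Y given X, and let f = (f₁,…,fₙ) : E → (ℝ^d)ⁿ be measurable with Δ_n(f) < ∞. Then Δ_n(f) = E[W₂(Q(X,·), Q̂_f(X,·))²], where Q̂_f(x,·) = Σ_{i=1}^n Q(x, {y : π_{f(x)}(y) = f_i(x)}) δ_{f_i(x)}; in particular, minimizing Δ_n(f) is equivalent to minimizing the expected squared Wasserstein distance between the true conditional law and its quantized approximation. -/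
open MeasureTheory ProbabilityTheory ENNReal

/-- If `g` is a nearest-point map onto the finite range of `a`, then the squared distance from `y`
to `g y` is the minimal squared distance from `y` to the points `a i`. -/
lemma enorm_sq_sub_nearest_eq_iInf {d n : ℕ} {a : Fin n → EuclideanSpace ℝ (Fin d)}
    {g : EuclideanSpace ℝ (Fin d) → EuclideanSpace ℝ (Fin d)}
    (hg_mem : ∀ y, ∃ i, g y = a i) (hg_near : ∀ y, ‖y - g y‖ = ⨅ i, ‖y - a i‖)
    (y : EuclideanSpace ℝ (Fin d)) :
    ((‖y - g y‖₊ : ℝ≥0∞) ^ 2) = ⨅ i, ((‖y - a i‖₊ : ℝ≥0∞) ^ 2) := by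
  refine le_antisymm (le_iInf fun i => ?_) ?_
  · have h : ‖y - g y‖₊ ≤ ‖y - a i‖₊ := by
      rw [← NNReal.coe_le_coe, coe_nnnorm, coe_nnnorm, hg_near y]
      exact ciInf_le (Set.finite_range _).bddBelow i
    gcongr
  · obtain ⟨i, hi⟩ := hg_mem y
    rw [hi]
    exact iInf_le _ i

/-- The squared Wasserstein distance between `μ` and its image under a nearest-point map onto a
finite set is the quantization error. -/
lemma W2_map_nearest_sq_s12 {d n : ℕ} (μ : Measure (EuclideanSpace ℝ (Fin d)))
    {a : Fin n → EuclideanSpace ℝ (Fin d)}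
    {g : EuclideanSpace ℝ (Fin d) → EuclideanSpace ℝ (Fin d)} (hg : Measurable g)
    (hg_mem : ∀ y, ∃ i, g y = a i) (hg_near : ∀ y, ‖y - g y‖ = ⨅ i, ‖y - a i‖) :
    W2 μ (μ.map g) ^ 2 = ∫⁻ y, ⨅ i, ((‖y - a i‖₊ : ℝ≥0∞) ^ 2) ∂μ := by
  have hW : W2 μ (μ.map g)
      = (∫⁻ y, ⨅ i, ((‖y - a i‖₊ : ℝ≥0∞) ^ 2) ∂μ) ^ ((1 : ℝ) / 2) := by
    refine le_antisymm ?_ (le_iInf₂ fun π hπ => ?_)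
    · have hpair : Measurable fun y => (y, g y) := measurable_id.prodMk hg
      have hcoupling : IsCoupling (μ.map fun y => (y, g y)) μ (μ.map g) := by
        constructor
        · rw [Measure.map_map measurable_fst hpair]
          exact Measure.map_id
        · rw [Measure.map_map measurable_snd hpair]
          rfl
      refine le_trans (iInf₂_le (μ.map fun y => (y, g y)) hcoupling) (le_of_eq ?_)
      rw [lintegral_map (by fun_prop) hpair]
      simp_rw [enorm_sq_sub_nearest_eq_iInf hg_mem hg_near]
    · obtain ⟨hfst, hsnd⟩ := hπ
      have hmem : ∀ᵐ q ∂π, q.2 ∈ Set.range a := by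
        refine ae_of_ae_map (p := fun y => y ∈ Set.range a) measurable_snd.aemeasurable ?_
        rw [hsnd]
        refine (ae_map_iff hg.aemeasurable (Set.finite_range a).measurableSet).2 ?_
        exact ae_of_all _ fun y => (hg_mem y).imp fun i hi => hi.symm
      have hmeas : Measurable fun y : EuclideanSpace ℝ (Fin d) =>
          ⨅ i, ((‖y - a i‖₊ : ℝ≥0∞) ^ 2) := Measurable.iInf fun i => by fun_prop
      rw [← hfst, lintegral_map hmeas measurable_fst]
      refine ENNReal.rpow_le_rpow (lintegral_mono_ae ?_) (by norm_num)
      filter_upwards [hmem] with q ⟨i, hi⟩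
      rw [← hi]
      exact iInf_le _ i
  rw [hW, ← ENNReal.rpow_natCast, ← ENNReal.rpow_mul]
  norm_num

/-- Theorem 1, part 2: with `Q` a regular conditional distribution of `Y`
given `X`, `f : E → (ℝ^d)ⁿ` measurable with `Δ_n(f) < ∞`, and `p x = π_{f(x)}` a jointly
measurable nearest-neighbor projection, the conditional distortion satisfies
`Δ_n(f) = E[W₂(Q(X,·), Q̂_f(X,·))²]`, where `Q̂_f(x,·) = (Q x).map (p x)` is the conditional
law of `π_{f(X)}(Y)` given `X = x`. -/
theorem conditional_distortion_eq_expected_wasserstein_sq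
    {Ω : Type*} [MeasurableSpace Ω] (P : Measure Ω) [IsProbabilityMeasure P]
    {E : Type*} [MeasurableSpace E]
    {d n : ℕ} (hn : 1 ≤ n)
    (X : Ω → E) (hX : Measurable X)
    (Y : Ω → EuclideanSpace ℝ (Fin d)) (hY : Measurable Y)
    (Q : Kernel E (EuclideanSpace ℝ (Fin d))) [IsMarkovKernel Q]
    (hQ : P.map (fun ω => (X ω, Y ω)) = (P.map X).compProd Q)
    (f : E → Fin n → EuclideanSpace ℝ (Fin d)) (hf : Measurable f)
    (hΔ : ∫⁻ ω, ⨅ i, ((‖Y ω - f (X ω) i‖₊ : ℝ≥0∞) ^ 2) ∂P < ⊤)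
    (p : E → EuclideanSpace ℝ (Fin d) → EuclideanSpace ℝ (Fin d))
    (hp_meas : Measurable (fun q : E × EuclideanSpace ℝ (Fin d) => p q.1 q.2))
    (hp_mem : ∀ x y, ∃ i, p x y = f x i)
    (hp_near : ∀ x y, ‖y - p x y‖ = ⨅ i, ‖y - f x i‖) :
    ∫⁻ ω, ⨅ i, ((‖Y ω - f (X ω) i‖₊ : ℝ≥0∞) ^ 2) ∂P
      = ∫⁻ ω, W2 (Q (X ω)) ((Q (X ω)).map (p (X ω))) ^ 2 ∂P := by
  have hG : Measurable fun q : E × EuclideanSpace ℝ (Fin d) =>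
      ⨅ i, ((‖q.2 - f q.1 i‖₊ : ℝ≥0∞) ^ 2) := Measurable.iInf fun i => by fun_prop
  have hW : ∀ x, W2 (Q x) ((Q x).map (p x)) ^ 2
      = ∫⁻ y, ⨅ i, ((‖y - f x i‖₊ : ℝ≥0∞) ^ 2) ∂(Q x) := fun x =>
    W2_map_nearest_sq_s12 (Q x) (hp_meas.comp measurable_prodMk_left) (hp_mem x) (hp_near x)
  simp_rw [hW]
  rw [← lintegral_map hG (hX.prodMk hY), hQ, Measure.lintegral_compProd hG,
    lintegral_map hG.lintegral_kernel_prod_right' hX]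
end

section
/- (Theorem 2, existence) Let X be a random element of a measurable space E and Y a random vector in ℝ^d on the same probability space, with regular conditional distribution Q(x, dy) of Y given X, and suppose there exists a measurable f : E → (ℝ^d)ⁿ with Δ_n(f) < ∞. Then there exists a measurable quantizer f* : E → (ℝ^d)ⁿ attaining the infimum: Δ_n(f*) = inf over measurable f of Δ_n(f). -/
open MeasureTheory ProbabilityTheory ENNReal
open Filter Topology

/-- In a complete linear order with the order topology, the lower limit of a sequence is one of
its cluster points. -/
lemma mapClusterPt_liminf_atTop {K : Type*} [CompleteLinearOrder K] [TopologicalSpace K]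
    [OrderTopology K] (u : ℕ → K) : MapClusterPt (liminf u atTop) atTop u := by
  set L := liminf u atTop with hL
  rw [mapClusterPt_iff_frequently]
  intro s hs
  have hlow : ∀ᶠ k in atTop, ∀ c, c < L → ∃ l < L, Set.Ioc l L ⊆ s ∧ l < u k := by
    by_cases h : ∃ c, c < L
    · obtain ⟨l, hl, hls⟩ := exists_Ioc_subset_of_mem_nhds hs h
      filter_upwards [eventually_lt_of_lt_liminf (hL ▸ hl)] with k hk c _
      exact ⟨l, hl, hls, hk⟩
    · exact Eventually.of_forall fun k c hc => (h ⟨c, hc⟩).elim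
  have key : ∃ᶠ k in atTop, u k ≤ L ∨ u k ∈ s := by
    by_cases h : ∃ c, L < c
    · obtain ⟨r, hr, hrs⟩ := exists_Ico_subset_of_mem_nhds hs h
      have := frequently_lt_of_liminf_lt (f := atTop) (u := u) (h := hL ▸ hr)
      refine this.mono fun k hk => ?_
      rcases le_total (u k) L with h1 | h1
      · exact Or.inl h1
      · exact Or.inr (hrs ⟨h1, hk⟩)
    · push Not at h
      exact Frequently.of_forall fun k => Or.inl (h _)
  refine (key.and_eventually hlow).mono ?_
  rintro k ⟨h1 | h1, h2⟩
  · rcases h1.lt_or_eq with h3 | h3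
    · obtain ⟨l, -, hls, hlk⟩ := h2 _ h3
      exact hls ⟨hlk, h1⟩
    · exact h3 ▸ mem_of_mem_nhds hs
  · exact h1

/-- A sequence of measurable extended-real functions has, at every point, a subsequence converging
to the lower limit, along indices that depend measurably on the point. -/
lemma exists_measurable_index_tendsto_liminf {E : Type*} [MeasurableSpace E]
    (u : ℕ → E → EReal) (hu : ∀ k, Measurable (u k)) :
    ∃ τ : ℕ → E → ℕ, (∀ k, Measurable (τ k)) ∧ (∀ k x, k ≤ τ k x) ∧
      ∀ x, Tendsto (fun k => u (τ k x) x) atTop (𝓝 (liminf (fun k => u k x) atTop)) := by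
  classical
  let := TopologicalSpace.metrizableSpaceMetric EReal
  set L : E → EReal := fun x => liminf (fun k => u k x) atTop with hL
  have hLm : Measurable L := Measurable.liminf hu
  have hex : ∀ (j : ℕ) (x : E), ∃ k, j ≤ k ∧ dist (u k x) (L x) < 1 / ((j : ℝ) + 1) := by
    intro j x
    have h := (mapClusterPt_iff_frequently.1 (mapClusterPt_liminf_atTop (fun k => u k x)))
      (Metric.ball (L x) (1 / ((j : ℝ) + 1))) (Metric.ball_mem_nhds _ (by positivity))
    obtain ⟨k, hk, hk'⟩ := (frequently_atTop.1 h) j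
    exact ⟨k, hk, hk'⟩
  refine ⟨fun j x => Nat.find (hex j x), fun j => ?_, fun j x => (Nat.find_spec (hex j x)).1,
    fun x => ?_⟩
  · refine measurable_find (hex j) fun k => ?_
    exact (MeasurableSet.const _).inter
      (measurableSet_lt ((hu k).dist hLm) measurable_const)
  · rw [tendsto_iff_dist_tendsto_zero]
    exact squeeze_zero (fun _ => dist_nonneg) (fun j => (Nat.find_spec (hex j x)).2.le)
      tendsto_one_div_add_atTop_nhds_zero_nat

/-- Evaluating a sequence of measurable functions at a measurable index is measurable. -/
lemma measurable_apply_index {E F : Type*} [MeasurableSpace E] [MeasurableSpace F]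
    {g : ℕ → E → F} (hg : ∀ k, Measurable (g k)) {σ : E → ℕ} (hσ : Measurable σ) :
    Measurable fun x => g (σ x) x :=
  (measurable_from_prod_countable_right (f := fun p : ℕ × E => g p.1 p.2) hg).comp
    (hσ.prodMk measurable_id)

/-- Finitely many sequences of measurable extended-real functions have pointwise convergent
subsequences along common indices depending measurably on the point. -/
lemma exists_measurable_index_tendsto {E ι : Type*} [MeasurableSpace E]
    (g : ι → ℕ → E → EReal) (hg : ∀ i k, Measurable (g i k)) (s : Finset ι) :
    ∃ τ : ℕ → E → ℕ, (∀ k, Measurable (τ k)) ∧ (∀ k x, k ≤ τ k x) ∧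
      ∀ i ∈ s, ∃ L : E → EReal, Measurable L ∧
        ∀ x, Tendsto (fun k => g i (τ k x) x) atTop (𝓝 (L x)) := by
  classical
  induction s using Finset.induction_on with
  | empty => exact ⟨fun k _ => k, fun k => measurable_const, fun k x => le_rfl, by simp⟩
  | insert a s ha ih =>
    obtain ⟨τ, hτ, hle, hlim⟩ := ih
    have hu : ∀ k, Measurable fun x => g a (τ k x) x :=
      fun k => measurable_apply_index (hg a) (hτ k)
    obtain ⟨σ, hσ, hle', hlim'⟩ := exists_measurable_index_tendsto_liminf _ hu
    refine ⟨fun k x => τ (σ k x) x, fun k => measurable_apply_index hτ (hσ k),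
      fun k x => (hle' k x).trans (hle _ x), fun i hi => ?_⟩
    rcases Finset.mem_insert.1 hi with rfl | hi
    · exact ⟨_, Measurable.liminf hu, hlim'⟩
    · obtain ⟨L, hL, hLlim⟩ := hlim i hi
      exact ⟨L, hL, fun x => (hLlim x).comp (tendsto_atTop_mono (fun k => hle' k x) tendsto_id)⟩

/-- If the coordinates of `a k` converge in the extended reals, then replacing infinite limits by
`0` gives a point whose squared distance to `y` is at most the lower limit of those of `a k`. -/
lemma enorm_sub_toReal_sq_le_liminf {d : ℕ} (y : EuclideanSpace ℝ (Fin d))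
    (a : ℕ → EuclideanSpace ℝ (Fin d)) (L : Fin d → EReal)
    (h : ∀ j, Tendsto (fun k => ((a k j : ℝ) : EReal)) atTop (𝓝 (L j))) :
    (‖y - WithLp.toLp 2 (fun j => (L j).toReal)‖₊ : ℝ≥0∞) ^ 2
      ≤ liminf (fun k => (‖y - a k‖₊ : ℝ≥0∞) ^ 2) atTop := by
  by_cases hfin : ∀ j, L j ≠ ⊤ ∧ L j ≠ ⊥
  · have h1 : Tendsto a atTop (𝓝 (WithLp.toLp 2 (fun j => (L j).toReal))) := by
      have h2 : Tendsto (fun k => (fun j => a k j)) atTop (𝓝 (fun j => (L j).toReal)) := by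
        rw [tendsto_pi_nhds]
        intro j
        exact (EReal.tendsto_toReal (hfin j).1 (hfin j).2).comp (h j)
      exact ((PiLp.continuous_toLp 2 _).tendsto _).comp h2
    have h2 : Continuous fun b : EuclideanSpace ℝ (Fin d) => (‖y - b‖₊ : ℝ≥0∞) ^ 2 :=
      (ENNReal.continuous_pow 2).comp
        (ENNReal.continuous_coe.comp (continuous_const.sub continuous_id).nnnorm)
    exact ((h2.tendsto _).comp h1).liminf_eq.ge
  · push Not at hfin
    obtain ⟨j, hj⟩ := hfin
    have habs : Tendsto (fun k => |a k j|) atTop atTop := by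
      by_cases htop : L j = ⊤
      · have := h j
        rw [htop, EReal.tendsto_coe_nhds_top_iff] at this
        exact tendsto_abs_atTop_atTop.comp this
      · have := h j
        rw [hj htop, EReal.tendsto_coe_nhds_bot_iff] at this
        exact tendsto_abs_atBot_atTop.comp this
    have hnorm : Tendsto (fun k => ‖y - a k‖) atTop atTop := by
      refine tendsto_atTop_mono (fun k => ?_) (tendsto_atTop_add_const_right _ (-|y j|) habs)
      have h1 : ‖(y - a k) j‖ ≤ ‖y - a k‖ := PiLp.norm_apply_le _ _
      have h2 : |a k j| - |y j| ≤ |a k j - y j| := abs_sub_abs_le_abs_sub _ _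
      rw [PiLp.sub_apply, Real.norm_eq_abs, abs_sub_comm] at h1
      linarith
    have htop : Tendsto (fun k => (‖y - a k‖₊ : ℝ≥0∞) ^ 2) atTop (𝓝 ⊤) := by
      have h1 := ENNReal.tendsto_ofReal_atTop.comp hnorm
      have h2 := ((ENNReal.continuous_pow 2).tendsto ⊤).comp h1
      simpa [Function.comp_def, ofReal_norm, enorm_eq_nnnorm] using h2
    rw [htop.liminf_eq]
    exact le_top

/-- A finite infimum of lower limits is at most the lower limit of the infima. -/
lemma iInf_liminf_le_liminf_iInf {ι : Type*} [Finite ι] (v : ι → ℕ → ℝ≥0∞) :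
    ⨅ i, liminf (v i) atTop ≤ liminf (fun k => ⨅ i, v i k) atTop := by
  refine le_of_forall_lt fun c hc => ?_
  obtain ⟨c', hcc', hc'⟩ := exists_between hc
  refine hcc'.trans_le (le_liminf_of_le (by isBoundedDefault) ?_)
  have : ∀ᶠ k in atTop, ∀ i, c' < v i k :=
    eventually_all.2 fun i => eventually_lt_of_lt_liminf (hc'.trans_le (iInf_le _ i))
  exact this.mono fun k hk => le_iInf fun i => (hk i).le

lemma measurable_iInf_enorm_sub_sq {d n : ℕ} {α : Type*} [MeasurableSpace α]
    {y : α → EuclideanSpace ℝ (Fin d)} (hy : Measurable y)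
    {f : α → Fin n → EuclideanSpace ℝ (Fin d)} (hf : Measurable f) :
    Measurable fun p => ⨅ i, (‖y p - f p i‖₊ : ℝ≥0∞) ^ 2 :=
  Measurable.iInf fun i =>
    ((hy.sub ((measurable_pi_apply i).comp hf)).nnnorm.coe_nnreal_ennreal).pow_const 2

/-- Given a sequence of measurable quantizers, some measurable quantizer is pointwise at least as
good as all of them. -/
lemma exists_measurable_quantizer_le {E : Type*} [MeasurableSpace E] {d n : ℕ}
    (Q : Kernel E (EuclideanSpace ℝ (Fin d))) [IsSFiniteKernel Q]
    (f : ℕ → E → Fin n → EuclideanSpace ℝ (Fin d)) (hf : ∀ k, Measurable (f k)) :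
    ∃ fstar : E → Fin n → EuclideanSpace ℝ (Fin d), Measurable fstar ∧ ∀ k x,
      ∫⁻ y, ⨅ i, (‖y - fstar x i‖₊ : ℝ≥0∞) ^ 2 ∂Q x
        ≤ ∫⁻ y, ⨅ i, (‖y - f k x i‖₊ : ℝ≥0∞) ^ 2 ∂Q x := by
  classical
  set V : E → (Fin n → EuclideanSpace ℝ (Fin d)) → ℝ≥0∞ :=
    fun x a => ∫⁻ y, ⨅ i, (‖y - a i‖₊ : ℝ≥0∞) ^ 2 ∂Q x with hV
  have hVm : ∀ h : E → Fin n → EuclideanSpace ℝ (Fin d), Measurable h →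
      Measurable fun x => V x (h x) := fun h hh =>
    Measurable.lintegral_kernel_prod_right
      (measurable_iInf_enorm_sub_sq measurable_snd (hh.comp measurable_fst))
  let g : ℕ → E → Fin n → EuclideanSpace ℝ (Fin d) := fun k =>
    Nat.rec (f 0) (fun k gk x => if V x (f (k + 1) x) < V x (gk x) then f (k + 1) x else gk x) k
  have hgs : ∀ k x, g (k + 1) x =
      if V x (f (k + 1) x) < V x (g k x) then f (k + 1) x else g k x := fun _ _ => rfl
  have hgm : ∀ k, Measurable (g k) := by
    intro k
    induction k with
    | zero => exact hf 0
    | succ k ih => exact Measurable.ite (measurableSet_lt (hVm _ (hf _)) (hVm _ ih)) (hf _) ih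
  have hganti : ∀ x, Antitone fun k => V x (g k x) := by
    intro x
    refine antitone_nat_of_succ_le fun k => ?_
    simp only [hgs]
    split_ifs with h
    exacts [h.le, le_rfl]
  have hgf : ∀ k x, V x (g k x) ≤ V x (f k x) := by
    intro k x
    cases k with
    | zero => exact le_rfl
    | succ k =>
      simp only [hgs]
      split_ifs with h
      exacts [le_rfl, not_lt.1 h]
  obtain ⟨τ, -, hle, hlim⟩ := exists_measurable_index_tendsto
    (fun (p : Fin n × Fin d) k x => ((g k x p.1 p.2 : ℝ) : EReal))
    (fun p k => by
      have h1 : Measurable fun x => g k x p.1 := (measurable_pi_apply _).comp (hgm k)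
      have h2 : Measurable fun z : EuclideanSpace ℝ (Fin d) => z p.2 := by fun_prop
      exact measurable_coe_real_ereal.comp (h2.comp h1)) Finset.univ
  choose L hLm hL using fun p => hlim p (Finset.mem_univ p)
  refine ⟨fun x i => WithLp.toLp 2 fun j => (L (i, j) x).toReal, ?_, fun k x => ?_⟩
  · refine measurable_pi_lambda _ fun i => ?_
    exact (PiLp.continuous_toLp 2 _).measurable.comp
      (measurable_pi_lambda _ fun j => (hLm (i, j)).ereal_toReal)
  · calc _ ≤ ∫⁻ y, liminf (fun m => ⨅ i, (‖y - g (τ m x) x i‖₊ : ℝ≥0∞) ^ 2) atTop ∂Q x := by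
          refine lintegral_mono fun y => ?_
          refine le_trans (iInf_mono fun i => ?_) (iInf_liminf_le_liminf_iInf _)
          exact enorm_sub_toReal_sq_le_liminf y (fun m => g (τ m x) x i) _ fun j => hL (i, j) x
      _ ≤ liminf (fun m => V x (g (τ m x) x)) atTop :=
          lintegral_liminf_le fun m =>
            measurable_iInf_enorm_sub_sq measurable_id measurable_const
      _ ≤ V x (g k x) := by
          refine liminf_le_of_frequently_le' (Eventually.frequently ?_)
          filter_upwards [eventually_ge_atTop k] with m hm
          exact hganti x (hm.trans (hle m x))
      _ ≤ V x (f k x) := hgf k x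

/-- Theorem 2, existence: with `Q` a regular conditional distribution of `Y`
given `X`, if some measurable `f : E → (ℝ^d)ⁿ` has finite conditional distortion
`Δ_n(f) = E[min_{1≤i≤n} |Y − f_i(X)|²] < ∞`, then there exists a measurable quantizer
`f* : E → (ℝ^d)ⁿ` attaining the infimum: `Δ_n(f*) = inf over measurable f of Δ_n(f)`. -/
theorem exists_optimal_conditional_quantizer
    {Ω : Type*} [MeasurableSpace Ω] (P : Measure Ω) [IsProbabilityMeasure P]
    {E : Type*} [MeasurableSpace E]
    {d n : ℕ} (hn : 1 ≤ n)
    (X : Ω → E) (hX : Measurable X)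
    (Y : Ω → EuclideanSpace ℝ (Fin d)) (hY : Measurable Y)
    (Q : Kernel E (EuclideanSpace ℝ (Fin d))) [IsMarkovKernel Q]
    (hQ : P.map (fun ω => (X ω, Y ω)) = (P.map X).compProd Q)
    (hfin : ∃ f : E → Fin n → EuclideanSpace ℝ (Fin d), Measurable f ∧
      ∫⁻ ω, ⨅ i, ((‖Y ω - f (X ω) i‖₊ : ℝ≥0∞) ^ 2) ∂P < ⊤) :
    ∃ fstar : E → Fin n → EuclideanSpace ℝ (Fin d), Measurable fstar ∧
      ∫⁻ ω, ⨅ i, ((‖Y ω - fstar (X ω) i‖₊ : ℝ≥0∞) ^ 2) ∂P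
        = ⨅ (f : E → Fin n → EuclideanSpace ℝ (Fin d)) (_ : Measurable f),
            ∫⁻ ω, ⨅ i, ((‖Y ω - f (X ω) i‖₊ : ℝ≥0∞) ^ 2) ∂P := by
  set D : (E → Fin n → EuclideanSpace ℝ (Fin d)) → ℝ≥0∞ :=
    fun f => ∫⁻ ω, ⨅ i, ((‖Y ω - f (X ω) i‖₊ : ℝ≥0∞) ^ 2) ∂P with hD
  have hdis : ∀ f, Measurable f →
      D f = ∫⁻ x, ∫⁻ y, ⨅ i, (‖y - f x i‖₊ : ℝ≥0∞) ^ 2 ∂Q x ∂(P.map X) := by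
    intro f hf
    have hm : Measurable fun p : E × EuclideanSpace ℝ (Fin d) =>
        ⨅ i, (‖p.2 - f p.1 i‖₊ : ℝ≥0∞) ^ 2 :=
      measurable_iInf_enorm_sub_sq measurable_snd (hf.comp measurable_fst)
    have := Measure.lintegral_compProd (μ := P.map X) (κ := Q) hm
    rw [← hQ, lintegral_map hm (hX.prodMk hY)] at this
    exact this
  have hne : (D '' {f | Measurable f}).Nonempty := ⟨_, 0, measurable_zero, rfl⟩
  obtain ⟨u, -, hu, hmem⟩ := exists_seq_tendsto_sInf hne (OrderBot.bddBelow _)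
  choose f hf hfu using hmem
  obtain ⟨fstar, hm, hle⟩ := exists_measurable_quantizer_le Q f hf
  refine ⟨fstar, hm, le_antisymm ?_ (iInf₂_le fstar hm)⟩
  rw [sInf_image] at hu
  refine ge_of_tendsto' hu fun k => ?_
  rw [← hfu k, hdis _ (hf k)]
  exact (hdis _ hm).le.trans (lintegral_mono fun x => hle k x)
end

section
/- (Theorem 2, optimality characterization) Let X be a random element of a measurable space E and Y a random vector in ℝ^d on the same probability space, with regular conditional distribution Q(x, dy) of Y given X, and suppose some measurable f has Δ_n(f) < ∞. If f* : E → (ℝ^d)ⁿ is any optimal conditional quantizer, i.e. Δ_n(f*) = inf over measurable f of Δ_n(f), then with probability 1, W₂(Q(X,·), Q̂_{f*}(X,·)) = min over ν ∈ P_n(ℝ^d) of W₂(Q(X,·), ν), where P_n(ℝ^d) is the set of probability measures on ℝ^d whose support has cardinality at most n. -/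
open MeasureTheory ProbabilityTheory ENNReal

/-- The (topological) support of a measure `ν` on `ℝ^d`: the set of points all of whose open
neighborhoods have positive measure. -/
def msupport {d : ℕ} (ν : Measure (EuclideanSpace ℝ (Fin d))) :
    Set (EuclideanSpace ℝ (Fin d)) :=
  {x | ∀ U : Set (EuclideanSpace ℝ (Fin d)), IsOpen U → x ∈ U → ν U ≠ 0}

/-- The quadratic quantization error of the measure `μ` by the grid `a`. -/
noncomputable def quantizationError {V ι : Type*} [NormedAddCommGroup V] [MeasurableSpace V]
    (μ : Measure V) (a : ι → V) : ℝ≥0∞ :=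
  ∫⁻ y, ⨅ i, ((‖y - a i‖₊ : ℝ≥0∞) ^ 2) ∂μ

section QuantizationError

variable {V ι : Type*} [NormedAddCommGroup V] [MeasurableSpace V] [BorelSpace V]

lemma sqrt_quantizationError_le_add [Fintype ι] [Nonempty ι] (μ : Measure V)
    [IsProbabilityMeasure μ] (a b : ι → V) :
    quantizationError μ b ^ (1 / 2 : ℝ) ≤ quantizationError μ a ^ (1 / 2 : ℝ) + edist a b := by
  set h : V → ℝ≥0∞ := fun y => ⨅ i, (‖y - a i‖₊ : ℝ≥0∞)
  have hm : Measurable h :=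
    .iInf fun i => (measurable_id.sub_const (a i)).nnnorm.coe_nnreal_ennreal
  have hb : quantizationError μ b ≤ ∫⁻ y, (h y + edist a b) ^ (2 : ℝ) ∂μ := by
    refine lintegral_mono fun y => ?_
    obtain ⟨i, hi⟩ := exists_eq_ciInf_of_finite (f := fun i => (‖y - a i‖₊ : ℝ≥0∞))
    refine (iInf_le _ i).trans ?_
    rw [ENNReal.rpow_two]
    gcongr
    change _ ≤ (⨅ i, (‖y - a i‖₊ : ℝ≥0∞)) + _
    rw [← hi]
    change ‖y - b i‖ₑ ≤ ‖y - a i‖ₑ + _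
    rw [← edist_eq_enorm_sub, ← edist_eq_enorm_sub]
    exact (edist_triangle y (a i) (b i)).trans (by gcongr; exact edist_le_pi_edist a b i)
  have ha : ∫⁻ y, h y ^ (2 : ℝ) ∂μ ≤ quantizationError μ a := by
    refine lintegral_mono fun y => le_iInf fun i => ?_
    rw [ENNReal.rpow_two]
    gcongr
    exact iInf_le _ i
  calc quantizationError μ b ^ (1 / 2 : ℝ)
      ≤ (∫⁻ y, (h y + edist a b) ^ (2 : ℝ) ∂μ) ^ (1 / 2 : ℝ) := by gcongr
    _ ≤ (∫⁻ y, h y ^ (2 : ℝ) ∂μ) ^ (1 / 2 : ℝ)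
          + (∫⁻ _, edist a b ^ (2 : ℝ) ∂μ) ^ (1 / 2 : ℝ) :=
        ENNReal.lintegral_Lp_add_le (p := 2) hm.aemeasurable aemeasurable_const (by norm_num)
    _ ≤ quantizationError μ a ^ (1 / 2 : ℝ) + edist a b := by
        gcongr
        rw [lintegral_const, measure_univ, mul_one, ← ENNReal.rpow_mul]
        norm_num

lemma le_quantizationError_of_dense [Fintype ι] [Nonempty ι] (μ : Measure V)
    [IsProbabilityMeasure μ] {s : Set (ι → V)} (hs : Dense s) {c : ℝ≥0∞}
    (hc : ∀ b ∈ s, c ≤ quantizationError μ b) (a : ι → V) : c ≤ quantizationError μ a := by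
  rw [← ENNReal.rpow_le_rpow_iff (z := 1 / 2) (by norm_num)]
  refine _root_.le_of_forall_pos_le_add fun ε hε => ?_
  obtain ⟨b, hb, hab⟩ := EMetric.mem_closure_iff.1 (hs a) ε hε
  calc c ^ (1 / 2 : ℝ) ≤ quantizationError μ b ^ (1 / 2 : ℝ) := by gcongr; exact hc b hb
    _ ≤ quantizationError μ a ^ (1 / 2 : ℝ) + edist a b := sqrt_quantizationError_le_add μ a b
    _ ≤ _ := by gcongr

variable [SecondCountableTopology V]

lemma measurable_iInf_nnnorm_sub_sq {α : Type*} [MeasurableSpace α] [Countable ι]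
    {g : α → V} (hg : Measurable g) {f : α → ι → V} (hf : Measurable f) :
    Measurable fun a => ⨅ i, ((‖g a - f a i‖₊ : ℝ≥0∞) ^ 2) :=
  .iInf fun i => (hg.sub ((measurable_pi_apply i).comp hf)).nnnorm.coe_nnreal_ennreal.pow_const 2

lemma measurable_quantizationError {E : Type*} [MeasurableSpace E] [Countable ι]
    (Q : Kernel E V) [IsSFiniteKernel Q] {f : E → ι → V} (hf : Measurable f) :
    Measurable fun x => quantizationError (Q x) (f x) :=
  Measurable.lintegral_kernel_prod_right
    (measurable_iInf_nnnorm_sub_sq measurable_snd (hf.comp measurable_fst))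

/-- A measurable minimizer of the integrated quantization error is pointwise optimal almost
everywhere. -/
lemma ae_forall_quantizationError_le {E : Type*} [MeasurableSpace E] [Fintype ι] [Nonempty ι]
    (m : Measure E) (Q : Kernel E V) [IsMarkovKernel Q] {f : E → ι → V} (hf : Measurable f)
    (hfin : ∫⁻ x, quantizationError (Q x) (f x) ∂m ≠ ⊤)
    (hopt : ∀ g : E → ι → V, Measurable g →
      ∫⁻ x, quantizationError (Q x) (f x) ∂m ≤ ∫⁻ x, quantizationError (Q x) (g x) ∂m) :
    ∀ᵐ x ∂m, ∀ a : ι → V, quantizationError (Q x) (f x) ≤ quantizationError (Q x) a := by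
  classical
  obtain ⟨s, hs, hsd⟩ := TopologicalSpace.exists_countable_dense (ι → V)
  have key : ∀ a ∈ s, ∀ᵐ x ∂m, quantizationError (Q x) (f x) ≤ quantizationError (Q x) a := by
    intro a _
    set A : Set E := {x | quantizationError (Q x) a < quantizationError (Q x) (f x)} with hA
    have hAm : MeasurableSet A := measurableSet_lt
      (measurable_quantizationError Q measurable_const) (measurable_quantizationError Q hf)
    set g : E → ι → V := A.piecewise (fun _ => a) f
    have hg : Measurable g := measurable_const.piecewise hAm hf
    have hle : ∀ x, quantizationError (Q x) (g x) ≤ quantizationError (Q x) (f x) := by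
      intro x
      by_cases hx : x ∈ A
      · simpa only [g, Set.piecewise_eq_of_mem _ _ _ hx] using le_of_lt hx
      · simp only [g, Set.piecewise_eq_of_notMem _ _ _ hx, le_refl]
    have heq := ae_eq_of_ae_le_of_lintegral_le (.of_forall hle)
      (ne_top_of_le_ne_top hfin (lintegral_mono hle))
      (measurable_quantizationError Q hf).aemeasurable (hopt g hg)
    filter_upwards [heq] with x hx
    by_contra! hlt
    have hxA : x ∈ A := hlt
    simp only [g, Set.piecewise_eq_of_mem _ _ _ hxA] at hx
    exact hlt.ne hx
  filter_upwards [(ae_ball_iff hs).2 key] with x hx a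
  exact le_quantizationError_of_dense (Q x) hsd hx a

end QuantizationError

lemma lintegral_iInf_eq_lintegral_quantizationError {Ω E V ι : Type*} [MeasurableSpace Ω]
    [MeasurableSpace E] [NormedAddCommGroup V] [MeasurableSpace V] [BorelSpace V]
    [SecondCountableTopology V] [Countable ι] {P : Measure Ω} [IsFiniteMeasure P]
    {X : Ω → E} (hX : Measurable X) {Y : Ω → V} (hY : Measurable Y)
    {Q : Kernel E V} [IsSFiniteKernel Q]
    (hQ : P.map (fun ω => (X ω, Y ω)) = (P.map X).compProd Q)
    {f : E → ι → V} (hf : Measurable f) :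
    ∫⁻ ω, ⨅ i, ((‖Y ω - f (X ω) i‖₊ : ℝ≥0∞) ^ 2) ∂P
      = ∫⁻ x, quantizationError (Q x) (f x) ∂(P.map X) := by
  have hm : Measurable fun q : E × V => ⨅ i, ((‖q.2 - f q.1 i‖₊ : ℝ≥0∞) ^ 2) :=
    measurable_iInf_nnnorm_sub_sq measurable_snd (hf.comp measurable_fst)
  rw [← lintegral_map (g := fun ω => (X ω, Y ω)) hm (hX.prodMk hY), hQ,
    Measure.lintegral_compProd hm]
  rfl

section Wasserstein

variable {d : ℕ}

lemma measure_compl_msupport (ν : Measure (EuclideanSpace ℝ (Fin d))) :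
    ν (msupport ν)ᶜ = 0 := by
  refine measure_null_of_locally_null _ fun x hx => ?_
  simp only [msupport, Set.mem_compl_iff, Set.mem_ofPred_eq, not_forall, not_not] at hx
  obtain ⟨U, hU, hxU, h0⟩ := hx
  exact ⟨U, mem_nhdsWithin_of_mem_nhds (hU.mem_nhds hxU), h0⟩

lemma msupport_subset_of_isClosed {ν : Measure (EuclideanSpace ℝ (Fin d))}
    {s : Set (EuclideanSpace ℝ (Fin d))} (hs : IsClosed s) (h : ν sᶜ = 0) :
    msupport ν ⊆ s := by
  intro x hx
  by_contra hxs
  exact hx sᶜ hs.isOpen_compl hxs h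

lemma Set.exists_subset_range_of_encard_le {V : Type*} [Nonempty V] {n : ℕ} {s : Set V}
    (hs : s.encard ≤ n) : ∃ a : Fin n → V, s ⊆ Set.range a := by
  have hfin : s.Finite := Set.finite_of_encard_le_coe hs
  have := hfin.fintype
  have hcard : Fintype.card s ≤ Fintype.card (Fin n) := by
    rw [Set.encard_eq_coe_toFinset_card, Set.toFinset_card] at hs
    rw [Fintype.card_fin]
    exact_mod_cast hs
  obtain ⟨e⟩ := Function.Embedding.nonempty_of_card_le hcard
  refine ⟨Function.extend e Subtype.val fun _ => Classical.arbitrary V, fun x hx => ?_⟩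
  exact ⟨e ⟨x, hx⟩, e.injective.extend_apply _ _ _⟩

lemma W2_map_le_sqrt_quantizationError {ι : Type*} (μ : Measure (EuclideanSpace ℝ (Fin d)))
    {q : EuclideanSpace ℝ (Fin d) → EuclideanSpace ℝ (Fin d)} (hq : Measurable q)
    {a : ι → EuclideanSpace ℝ (Fin d)} (hqa : ∀ y i, ‖y - q y‖ ≤ ‖y - a i‖) :
    W2 μ (μ.map q) ≤ quantizationError μ a ^ ((1 : ℝ) / 2) := by
  have hm : Measurable fun y => (y, q y) := measurable_id.prodMk hq
  have hc : IsCoupling (μ.map fun y => (y, q y)) μ (μ.map q) := by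
    constructor
    · rw [Measure.map_map measurable_fst hm]
      exact Measure.map_id
    · rw [Measure.map_map measurable_snd hm]
      rfl
  unfold W2
  refine iInf₂_le_of_le _ hc ?_
  rw [lintegral_map (by fun_prop) hm]
  refine ENNReal.rpow_le_rpow (lintegral_mono fun y => le_iInf fun i => ?_) (by norm_num)
  gcongr
  exact hqa y i

lemma sqrt_quantizationError_le_W2 {ι : Type*} [Countable ι]
    (μ ν : Measure (EuclideanSpace ℝ (Fin d))) {a : ι → EuclideanSpace ℝ (Fin d)}
    (hν : ν (Set.range a)ᶜ = 0) :
    quantizationError μ a ^ ((1 : ℝ) / 2) ≤ W2 μ ν := by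
  refine le_iInf₂ fun π hπ => ENNReal.rpow_le_rpow ?_ (by norm_num)
  have hae : ∀ᵐ q ∂π, q.2 ∈ Set.range a := by
    rw [← hπ.2] at hν
    exact ae_of_ae_map measurable_snd.aemeasurable hν
  rw [quantizationError, ← hπ.1, lintegral_map
    (measurable_iInf_nnnorm_sub_sq measurable_id' measurable_const) measurable_fst]
  refine lintegral_mono_ae ?_
  filter_upwards [hae] with q ⟨i, hi⟩
  rw [← hi]
  exact iInf_le _ i

end Wasserstein

/-- Theorem 2, optimality characterization: with `Q` a regular conditional
distribution of `Y` given `X`, if `f*` is an optimal conditional quantizer (it attains the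
infimum of `Δ_n` over measurable quantizers, which is finite) and `p x = π_{f*(x)}` is a
jointly measurable nearest-neighbor projection, then with probability `1`,
`W₂(Q(X,·), Q̂_{f*}(X,·)) = min_{ν ∈ P_n(ℝ^d)} W₂(Q(X,·), ν)`, where `P_n(ℝ^d)` is the set
of probability measures on `ℝ^d` with support of cardinality at most `n`, and
`Q̂_{f*}(x,·) = (Q x).map (p x)`. -/
theorem optimal_conditional_quantizer_wasserstein_min
    {Ω : Type*} [MeasurableSpace Ω] (P : Measure Ω) [IsProbabilityMeasure P]
    {E : Type*} [MeasurableSpace E]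
    {d n : ℕ} (hn : 1 ≤ n)
    (X : Ω → E) (hX : Measurable X)
    (Y : Ω → EuclideanSpace ℝ (Fin d)) (hY : Measurable Y)
    (Q : Kernel E (EuclideanSpace ℝ (Fin d))) [IsMarkovKernel Q]
    (hQ : P.map (fun ω => (X ω, Y ω)) = (P.map X).compProd Q)
    (hfin : ∃ f : E → Fin n → EuclideanSpace ℝ (Fin d), Measurable f ∧
      ∫⁻ ω, ⨅ i, ((‖Y ω - f (X ω) i‖₊ : ℝ≥0∞) ^ 2) ∂P < ⊤)
    (fstar : E → Fin n → EuclideanSpace ℝ (Fin d)) (hfstar : Measurable fstar)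
    (hopt : ∫⁻ ω, ⨅ i, ((‖Y ω - fstar (X ω) i‖₊ : ℝ≥0∞) ^ 2) ∂P
      = ⨅ (f : E → Fin n → EuclideanSpace ℝ (Fin d)) (_ : Measurable f),
          ∫⁻ ω, ⨅ i, ((‖Y ω - f (X ω) i‖₊ : ℝ≥0∞) ^ 2) ∂P)
    (p : E → EuclideanSpace ℝ (Fin d) → EuclideanSpace ℝ (Fin d))
    (hp_meas : Measurable (fun q : E × EuclideanSpace ℝ (Fin d) => p q.1 q.2))
    (hp_mem : ∀ x y, ∃ i, p x y = fstar x i)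
    (hp_near : ∀ x y, ‖y - p x y‖ = ⨅ i, ‖y - fstar x i‖) :
    ∀ᵐ ω ∂P,
      (msupport ((Q (X ω)).map (p (X ω)))).encard ≤ (n : ℕ∞) ∧
      ∀ ν : Measure (EuclideanSpace ℝ (Fin d)), IsProbabilityMeasure ν →
        (msupport ν).encard ≤ (n : ℕ∞) →
        W2 (Q (X ω)) ((Q (X ω)).map (p (X ω))) ≤ W2 (Q (X ω)) ν := by
  have : Nonempty (Fin n) := ⟨⟨0, hn⟩⟩
  have hΔ : ∀ f : E → Fin n → EuclideanSpace ℝ (Fin d), Measurable f →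
      ∫⁻ ω, ⨅ i, ((‖Y ω - f (X ω) i‖₊ : ℝ≥0∞) ^ 2) ∂P
        = ∫⁻ x, quantizationError (Q x) (f x) ∂(P.map X) :=
    fun f hf => lintegral_iInf_eq_lintegral_quantizationError hX hY hQ hf
  have hmin : ∀ g : E → Fin n → EuclideanSpace ℝ (Fin d), Measurable g →
      ∫⁻ x, quantizationError (Q x) (fstar x) ∂(P.map X)
        ≤ ∫⁻ x, quantizationError (Q x) (g x) ∂(P.map X) := by
    intro g hg
    rw [← hΔ fstar hfstar, ← hΔ g hg, hopt]
    exact iInf₂_le g hg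
  obtain ⟨f, hf, hf_lt⟩ := hfin
  rw [hΔ f hf] at hf_lt
  have hae := ae_of_ae_map hX.aemeasurable <| ae_forall_quantizationError_le (P.map X) Q hfstar
    ((hmin f hf).trans_lt hf_lt).ne hmin
  filter_upwards [hae] with ω hω
  have hp : Measurable (p (X ω)) := hp_meas.comp measurable_prodMk_left
  refine ⟨?_, fun ν _ hν => ?_⟩
  · have hfinite := Set.finite_range (fstar (X ω))
    have hsub : msupport ((Q (X ω)).map (p (X ω))) ⊆ Set.range (fstar (X ω)) := by
      refine msupport_subset_of_isClosed hfinite.isClosed ?_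
      rw [Measure.map_apply hp hfinite.measurableSet.compl]
      convert measure_empty (μ := Q (X ω))
      refine Set.eq_empty_of_forall_notMem fun y hy => hy ?_
      obtain ⟨i, hi⟩ := hp_mem (X ω) y
      exact ⟨i, hi.symm⟩
    calc _ ≤ (Set.range (fstar (X ω))).encard := Set.encard_le_encard hsub
      _ ≤ (Set.univ : Set (Fin n)).encard := by
        rw [← Set.image_univ]
        exact Set.encard_image_le _ _
      _ = n := by simp
  · obtain ⟨a, ha⟩ := Set.exists_subset_range_of_encard_le hν
    have hνa : ν (Set.range a)ᶜ = 0 :=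
      measure_mono_null (Set.compl_subset_compl.2 ha) (measure_compl_msupport ν)
    calc W2 (Q (X ω)) ((Q (X ω)).map (p (X ω)))
        ≤ quantizationError (Q (X ω)) (fstar (X ω)) ^ ((1 : ℝ) / 2) :=
          W2_map_le_sqrt_quantizationError _ hp fun y i =>
            (hp_near (X ω) y).trans_le (ciInf_le (Set.finite_range _).bddBelow i)
      _ ≤ quantizationError (Q (X ω)) a ^ ((1 : ℝ) / 2) := by
          gcongr
          exact hω a
      _ ≤ W2 (Q (X ω)) ν := sqrt_quantizationError_le_W2 _ _ hνa
end

section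
/- (Optimality transfers pointwise, key step in the proof of Theorem 2) Let X be a random element of a measurable space E and Y a random vector in ℝ^d on the same probability space, with regular conditional distribution Q(x, dy), and suppose some measurable g has Δ_n(g) < ∞. Let f, f* : E → (ℝ^d)ⁿ be measurable with Δ_n(f) = Δ_n(f*) = inf over measurable g of Δ_n(g), where f* is such that for almost every x, f*(x) is an optimal n-quantizer of Q(x,·). Then, with probability 1, ∫ min_{1≤i≤n} |y − f_i(X)|² Q(X,dy) = min over α ∈ (ℝ^d)ⁿ of ∫ min_{1≤i≤n} |y − α_i|² Q(X,dy); that is, f(X) is almost surely an optimal n-quantizer for Q(X,·). -/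
open MeasureTheory ProbabilityTheory ENNReal

theorem lintegral_comp_prodMk_eq_lintegral_kernel {Ω E F : Type*} [MeasurableSpace Ω]
    [MeasurableSpace E] [MeasurableSpace F] {P : Measure Ω} [SFinite P] {X : Ω → E}
    (hX : Measurable X) {Y : Ω → F} (hY : Measurable Y) {Q : Kernel E F} [IsSFiniteKernel Q]
    (hQ : P.map (fun ω => (X ω, Y ω)) = (P.map X).compProd Q)
    {φ : E × F → ℝ≥0∞} (hφ : Measurable φ) :
    ∫⁻ ω, φ (X ω, Y ω) ∂P = ∫⁻ ω, ∫⁻ y, φ (X ω, y) ∂(Q (X ω)) ∂P := by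
  rw [← lintegral_map hφ (hX.prodMk hY), hQ, Measure.lintegral_compProd hφ,
    lintegral_map hφ.lintegral_kernel_prod_right' hX]

theorem measurable_iInf_nnnorm_sub_sq_s15 {E F : Type*} [MeasurableSpace E] {n : ℕ}
    [NormedAddCommGroup F] [MeasurableSpace F] [BorelSpace F] [SecondCountableTopology F]
    {f : E → Fin n → F} (hf : Measurable f) :
    Measurable fun p : E × F => ⨅ i, ((‖p.2 - f p.1 i‖₊ : ℝ≥0∞) ^ 2) := by
  refine Measurable.iInf fun i => ?_
  have hfi : Measurable fun p : E × F => f p.1 i :=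
    (measurable_pi_apply i).comp (hf.comp measurable_fst)
  exact (measurable_snd.sub hfi).nnnorm.coe_nnreal_ennreal.pow_const 2

/-- Optimality transfers pointwise: with `Q` a regular conditional distribution
of `Y` given `X` and the infimum of `Δ_n` over measurable quantizers finite, let `f` and `f*`
be measurable quantizers both attaining `inf Δ_n`, where `f*(x)` is an optimal `n`-quantizer of
`Q(x,·)` for almost every `x`. Then, with probability `1`,
`∫ min_{1≤i≤n} |y − f_i(X)|² Q(X,dy) = min_{α ∈ (ℝ^d)ⁿ} ∫ min_{1≤i≤n} |y − α_i|² Q(X,dy)`;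
that is, `f(X)` is almost surely an optimal `n`-quantizer of `Q(X,·)`. -/
theorem optimal_conditional_quantizer_pointwise
    {Ω : Type*} [MeasurableSpace Ω] (P : Measure Ω) [IsProbabilityMeasure P]
    {E : Type*} [MeasurableSpace E]
    {d n : ℕ} (hn : 1 ≤ n)
    (X : Ω → E) (hX : Measurable X)
    (Y : Ω → EuclideanSpace ℝ (Fin d)) (hY : Measurable Y)
    (Q : Kernel E (EuclideanSpace ℝ (Fin d))) [IsMarkovKernel Q]
    (hQ : P.map (fun ω => (X ω, Y ω)) = (P.map X).compProd Q)
    (hfin : ∃ g : E → Fin n → EuclideanSpace ℝ (Fin d), Measurable g ∧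
      ∫⁻ ω, ⨅ i, ((‖Y ω - g (X ω) i‖₊ : ℝ≥0∞) ^ 2) ∂P < ⊤)
    (f fstar : E → Fin n → EuclideanSpace ℝ (Fin d))
    (hf : Measurable f) (hfstar : Measurable fstar)
    (hf_opt : ∫⁻ ω, ⨅ i, ((‖Y ω - f (X ω) i‖₊ : ℝ≥0∞) ^ 2) ∂P
      = ⨅ (g : E → Fin n → EuclideanSpace ℝ (Fin d)) (_ : Measurable g),
          ∫⁻ ω, ⨅ i, ((‖Y ω - g (X ω) i‖₊ : ℝ≥0∞) ^ 2) ∂P)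
    (hfstar_opt : ∫⁻ ω, ⨅ i, ((‖Y ω - fstar (X ω) i‖₊ : ℝ≥0∞) ^ 2) ∂P
      = ⨅ (g : E → Fin n → EuclideanSpace ℝ (Fin d)) (_ : Measurable g),
          ∫⁻ ω, ⨅ i, ((‖Y ω - g (X ω) i‖₊ : ℝ≥0∞) ^ 2) ∂P)
    (hfstar_pointwise : ∀ᵐ ω ∂P,
      ∫⁻ y, ⨅ i, ((‖y - fstar (X ω) i‖₊ : ℝ≥0∞) ^ 2) ∂(Q (X ω))
        = ⨅ α : Fin n → EuclideanSpace ℝ (Fin d),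
            ∫⁻ y, ⨅ i, ((‖y - α i‖₊ : ℝ≥0∞) ^ 2) ∂(Q (X ω))) :
    ∀ᵐ ω ∂P,
      ∫⁻ y, ⨅ i, ((‖y - f (X ω) i‖₊ : ℝ≥0∞) ^ 2) ∂(Q (X ω))
        = ⨅ α : Fin n → EuclideanSpace ℝ (Fin d),
            ∫⁻ y, ⨅ i, ((‖y - α i‖₊ : ℝ≥0∞) ^ 2) ∂(Q (X ω)) := by
  obtain ⟨g, hg, hg_lt⟩ := hfin
  have hmf := measurable_iInf_nnnorm_sub_sq_s15 (F := EuclideanSpace ℝ (Fin d)) hf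
  have hmfstar := measurable_iInf_nnnorm_sub_sq_s15 (F := EuclideanSpace ℝ (Fin d)) hfstar
  have hf_eq := lintegral_comp_prodMk_eq_lintegral_kernel hX hY hQ hmf
  have hfstar_eq := lintegral_comp_prodMk_eq_lintegral_kernel hX hY hQ hmfstar
  have hfstar_ne_top : ∫⁻ ω, ⨅ i, ((‖Y ω - fstar (X ω) i‖₊ : ℝ≥0∞) ^ 2) ∂P ≠ ⊤ := by
    rw [hfstar_opt]
    exact ((iInf₂_le g hg).trans_lt hg_lt).ne
  have h_le : ∀ᵐ ω ∂P, ∫⁻ y, ⨅ i, ((‖y - fstar (X ω) i‖₊ : ℝ≥0∞) ^ 2) ∂(Q (X ω))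
      ≤ ∫⁻ y, ⨅ i, ((‖y - f (X ω) i‖₊ : ℝ≥0∞) ^ 2) ∂(Q (X ω)) := by
    filter_upwards [hfstar_pointwise] with ω hω
    rw [hω]
    exact iInf_le _ (f (X ω))
  have h_ae := ae_eq_of_ae_le_of_lintegral_le h_le (hfstar_eq ▸ hfstar_ne_top)
    (hmf.lintegral_kernel_prod_right'.comp hX).aemeasurable
    (hf_eq.symm.trans (hf_opt.trans (hfstar_opt.symm.trans hfstar_eq))).le
  filter_upwards [h_ae, hfstar_pointwise] with ω h₁ h₂
  exact h₁.symm.trans h₂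
end
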